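/- Suppose F_τ(t) ∼ A t^m e^{-C/t} and F_τ^{(k)}(t) ∼ B t^n e^{-C_k/t} as t → 0⁺, with A, B > 0, C_k > C > 0, m, n ∈ ℝ, and σ is exponentially distributed with rate r > 0, independent of τ. Then P(κ = k | τ < σ) ∼ (B/A) · (C_k^{(2n+1)/4}/C^{(2m+1)/4}) · r^{(m-n)/2} · e^{-2(√C_k - √C)√r} as r → ∞. -/

import Mathlib

open MeasureTheory ProbabilityTheory Real Filter Set Topology

/-- For every real exponent, `s ^ p` is dominated by `exp ((s + s⁻¹) / 2)` on the positive reals. -/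
lemma exists_rpow_le_mul_exp (p : ℝ) :
    ∃ K > 0, ∀ s > 0, s ^ p ≤ K * exp ((s + 1 / s) / 2) := by
  have ha : (1 : ℝ) ≤ 2 * |p| + 1 := by linarith [abs_nonneg p]
  set a := 2 * |p| + 1 with hadef
  have hpa : |p| / a ≤ 1 / 2 := by
    rw [div_le_div_iff₀ (by linarith) (by norm_num)]; linarith
  refine ⟨exp (|p| * log a), exp_pos _, fun s hs => ?_⟩
  have hlog : |log s| ≤ (s + 1 / s) / a + log a := by
    have key : ∀ z > 0, log z ≤ z / a + log a := by
      intro z hz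
      have h := Real.log_le_sub_one_of_pos (div_pos hz (by linarith : 0 < a))
      rw [Real.log_div hz.ne' (by linarith)] at h
      linarith
    have h1 := key s hs
    have h2 := key (1 / s) (by positivity)
    rw [one_div, Real.log_inv, ← one_div] at h2
    have h3 : 0 < s / a := by positivity
    have h4 : 0 < 1 / s / a := by positivity
    rw [add_div]
    exact abs_le.2 ⟨by linarith, by linarith⟩
  rw [Real.rpow_def_of_pos hs, ← Real.exp_add]
  refine Real.exp_le_exp.2 ?_
  have hs' : 0 < s + 1 / s := by positivity
  calc log s * p ≤ |p| * |log s| := by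
        rw [mul_comm, ← abs_mul]; exact le_abs_self _
    _ ≤ |p| * ((s + 1 / s) / a + log a) := by gcongr
    _ = |p| * log a + |p| / a * (s + 1 / s) := by ring
    _ ≤ |p| * log a + 1 / 2 * (s + 1 / s) := by gcongr
    _ = _ := by ring

/-- A bounded function with small-time behaviour `A t ^ m exp (-C / t)` is globally dominated by
a constant times `(t ^ m + t ^ |m|) exp (-C / t)`. -/
lemma exists_le_mul_of_tendsto_div {G : ℝ → ℝ} {A C m : ℝ}
    (hG1 : ∀ t, G t ≤ 1) (hA : 0 < A) (hC : 0 < C)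
    (hG : Tendsto (fun t => G t / (A * t ^ m * exp (-C / t))) (𝓝[>] 0) (𝓝 1)) :
    ∃ K > 0, ∀ t > 0, G t ≤ K * (t ^ m + t ^ |m|) * exp (-C / t) := by
  have h2 := hG.eventually_lt_const (by norm_num : (1 : ℝ) < 2)
  obtain ⟨δ, hδ, hδ'⟩ := mem_nhdsGT_iff_exists_Ioo_subset.1 h2
  have hδ : 0 < δ := hδ
  refine ⟨2 * A + exp (C / δ) / δ ^ |m|, by positivity, fun t ht => ?_⟩
  have htm : 0 < t ^ m := by positivity
  have htm' : 0 < t ^ |m| := by positivity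
  have hδm : 0 < δ ^ |m| := by positivity
  rcases lt_or_ge t δ with h | h
  · have := hδ' ⟨ht, h⟩
    simp only [mem_ofPred_eq] at this
    rw [div_lt_iff₀ (by positivity)] at this
    refine this.le.trans ?_
    rw [← mul_assoc]
    gcongr ?_ * _
    have : 0 < exp (C / δ) / δ ^ |m| := by positivity
    nlinarith [mul_pos this htm, mul_pos this htm', mul_pos hA htm']
  · refine (hG1 t).trans ?_
    have h3 : δ ^ |m| ≤ t ^ |m| := Real.rpow_le_rpow hδ.le h (abs_nonneg _)
    have h4 : exp (-C / δ) ≤ exp (-C / t) := by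
      refine Real.exp_le_exp.2 ?_
      rw [neg_div, neg_div, neg_le_neg_iff]
      gcongr
    calc (1 : ℝ) = (exp (C / δ) / δ ^ |m|) * δ ^ |m| * exp (-C / δ) := by
          rw [div_mul_cancel₀ _ hδm.ne', ← Real.exp_add, neg_div, add_neg_cancel, Real.exp_zero]
      _ ≤ (2 * A + exp (C / δ) / δ ^ |m|) * (t ^ m + t ^ |m|) * exp (-C / t) := by
          gcongr
          · linarith
          · linarith

lemma integrable_exp_neg_half_abs : Integrable (fun u : ℝ => exp (-(|u| / 2))) := by
  rw [← integrableOn_univ, ← Iic_union_Ioi (a := (0 : ℝ)), integrableOn_union]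
  constructor
  · refine (integrableOn_exp_mul_Iic (a := 1 / 2) (by norm_num) 0).congr_fun (fun u hu => ?_)
      measurableSet_Iic
    simp only [abs_of_nonpos (mem_Iic.1 hu)]
    congr 1
    ring
  · refine (integrableOn_exp_mul_Ioi (a := -(1 / 2)) (by norm_num) 0).congr_fun (fun u hu => ?_)
      measurableSet_Ioi
    simp only [abs_of_pos (mem_Ioi.1 hu)]
    congr 1
    ring

/-- Recentering the exponent at the saddle point `s = 1`. -/
lemma saddle_exponent_eq {y u : ℝ} (hy : 0 < y) (hs : 0 < 1 + u / y) :
    -y ^ 2 / (1 + u / y) + (2 * y ^ 2 - y ^ 2 * (1 + u / y)) = -(u ^ 2 / (1 + u / y)) := by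
  have h : y + u ≠ 0 := by
    have := mul_pos hy hs
    rw [mul_add, mul_div_cancel₀ _ hy.ne'] at this
    linarith
  have : 1 + u / y = (y + u) / y := by field_simp
  rw [this]
  field_simp
  ring

/-- The rescaled saddle-point integrand has an integrable majorant independent of `y`. -/
lemma exists_rescaled_le {G : ℝ → ℝ} {A C m : ℝ}
    (hG1 : ∀ t, G t ≤ 1) (hGneg : ∀ t ≤ 0, G t = 0)
    (hA : 0 < A) (hC : 0 < C)
    (hG : Tendsto (fun t => G t / (A * t ^ m * exp (-C / t))) (𝓝[>] 0) (𝓝 1)) :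
    ∃ D : ℝ, ∀ y : ℝ, 1 ≤ y → C ≤ y ^ 2 → ∀ u : ℝ,
      G (C / y ^ 2 * (1 + u / y)) / (C / y ^ 2) ^ m * exp (2 * y ^ 2 - y ^ 2 * (1 + u / y))
        ≤ D * exp (-(|u| / 2)) := by
  obtain ⟨K, hK, hGK⟩ := exists_le_mul_of_tendsto_div hG1 hA hC hG
  obtain ⟨K₁, hK₁, h₁⟩ := exists_rpow_le_mul_exp m
  obtain ⟨K₂, hK₂, h₂⟩ := exists_rpow_le_mul_exp |m|
  refine ⟨K * (K₁ + K₂) * exp 1 * exp (1 / 2), fun y hy hCy u => ?_⟩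
  have hy0 : 0 < y := by linarith
  rcases le_or_gt (1 + u / y) 0 with hs | hs
  · rw [hGneg _ (mul_nonpos_of_nonneg_of_nonpos (by positivity) hs), zero_div, zero_mul]
    positivity
  set T := C / y ^ 2 with hT
  have hT0 : 0 < T := by positivity
  have hT1 : T ≤ 1 := by rw [hT, div_le_one (by positivity)]; exact hCy
  have hexp := saddle_exponent_eq hy0 hs
  set s := 1 + u / y with hsdef
  have hu : u = y * (s - 1) := by rw [hsdef]; field_simp; ring
  have hCT : -C / (T * s) = -y ^ 2 / s := by rw [hT]; field_simp
  have hpow : (T * s) ^ m + (T * s) ^ |m| ≤ T ^ m * (s ^ m + s ^ |m|) := by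
    rw [Real.mul_rpow hT0.le hs.le, Real.mul_rpow hT0.le hs.le, mul_add]
    have : T ^ |m| ≤ T ^ m := Real.rpow_le_rpow_of_exponent_ge hT0 hT1 (le_abs_self m)
    gcongr
  have hquad : -(u ^ 2 / s) + (s + 1 / s) / 2 ≤ 1 + 1 / 2 + -(|u| / 2) := by
    have e1 : (s + 1 / s) / 2 = 1 + (s - 1) ^ 2 / s / 2 := by field_simp; ring
    have e2 : (s - 1) ^ 2 / s ≤ u ^ 2 / s := by
      refine div_le_div_of_nonneg_right ?_ hs.le
      rw [hu, mul_pow]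
      nlinarith [sq_nonneg (s - 1), mul_nonneg (sq_nonneg (s - 1)) (by nlinarith : 0 ≤ y ^ 2 - 1)]
    have e3 : |u| - 1 ≤ u ^ 2 / s := by
      rw [le_div_iff₀ hs]
      have hs1 : s ≤ 1 + |u| := by
        have : u / y ≤ |u| := by
          rw [div_le_iff₀ hy0]
          nlinarith [le_abs_self u, abs_nonneg u]
        linarith
      rcases le_or_gt 1 |u| with h | h
      · nlinarith [sq_abs u]
      · nlinarith [sq_nonneg u]
    linarith
  calc G (T * s) / T ^ m * exp (2 * y ^ 2 - y ^ 2 * s)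
      ≤ (K * ((T * s) ^ m + (T * s) ^ |m|) * exp (-C / (T * s))) / T ^ m
          * exp (2 * y ^ 2 - y ^ 2 * s) := by
        gcongr
        exact hGK _ (by positivity)
    _ ≤ (K * (T ^ m * (s ^ m + s ^ |m|)) * exp (-C / (T * s))) / T ^ m
          * exp (2 * y ^ 2 - y ^ 2 * s) := by gcongr
    _ = K * (s ^ m + s ^ |m|) * exp (-(u ^ 2 / s)) := by
        rw [← hexp, Real.exp_add, hCT]
        field_simp
    _ ≤ K * (K₁ * exp ((s + 1 / s) / 2) + K₂ * exp ((s + 1 / s) / 2)) * exp (-(u ^ 2 / s)) := by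
        gcongr
        · exact h₁ s hs
        · exact h₂ s hs
    _ = K * (K₁ + K₂) * exp (-(u ^ 2 / s) + (s + 1 / s) / 2) := by
        rw [Real.exp_add]; ring
    _ ≤ K * (K₁ + K₂) * exp (1 + 1 / 2 + -(|u| / 2)) := by gcongr
    _ = _ := by rw [Real.exp_add, Real.exp_add]; ring

/-- Pointwise Gaussian limit of the rescaled saddle-point integrand. -/
lemma tendsto_rescaled {G : ℝ → ℝ} {A C m : ℝ} (hA : 0 < A) (hC : 0 < C)
    (hG : Tendsto (fun t => G t / (A * t ^ m * exp (-C / t))) (𝓝[>] 0) (𝓝 1)) (u : ℝ) :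
    Tendsto (fun y : ℝ => G (C / y ^ 2 * (1 + u / y)) / (C / y ^ 2) ^ m *
      exp (2 * y ^ 2 - y ^ 2 * (1 + u / y))) atTop (𝓝 (A * exp (-1 * u ^ 2))) := by
  have hs : Tendsto (fun y : ℝ => 1 + u / y) atTop (𝓝 1) := by
    simpa using (tendsto_const_nhds (x := (1 : ℝ))).add
      ((tendsto_const_nhds (x := u)).div_atTop tendsto_id)
  have hT : Tendsto (fun y : ℝ => C / y ^ 2) atTop (𝓝 0) :=
    tendsto_const_nhds.div_atTop (tendsto_pow_atTop two_ne_zero)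
  have hspos : ∀ᶠ y : ℝ in atTop, 0 < 1 + u / y := hs.eventually_const_lt one_pos
  have hTs : Tendsto (fun y : ℝ => C / y ^ 2 * (1 + u / y)) atTop (𝓝[>] 0) := by
    refine tendsto_nhdsWithin_iff.2 ⟨by simpa using hT.mul hs, ?_⟩
    filter_upwards [hspos, eventually_gt_atTop 0] with y h1 h2
    exact mul_pos (by positivity) h1
  have hlim := (((hG.comp hTs).mul_const A).mul
    (hs.rpow_const (p := m) (Or.inl one_ne_zero))).mul
    ((tendsto_const_nhds (x := u ^ 2)).div hs one_ne_zero).neg.rexp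
  simp only [one_mul, Real.one_rpow, mul_one, div_one] at hlim
  rw [neg_one_mul]
  refine hlim.congr' ?_
  filter_upwards [hspos, eventually_gt_atTop 0] with y hsy hy
  have hCT : -C / (C / y ^ 2 * (1 + u / y)) = -y ^ 2 / (1 + u / y) := by
    field_simp
  simp only [Function.comp_apply, Pi.div_apply]
  rw [← saddle_exponent_eq hy hsy, Real.exp_add, hCT, Real.mul_rpow (by positivity) hsy.le]
  generalize G (C / y ^ 2 * (1 + u / y)) = g
  have h1 : 0 < (1 + u / y) ^ m := by positivity
  have h2 : 0 < (C / y ^ 2) ^ m := by positivity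
  generalize (1 + u / y) ^ m = a at *
  generalize (C / y ^ 2) ^ m = b at *
  field_simp

/-- Laplace's method for the rescaled integral. -/
lemma tendsto_integral_rescaled {G : ℝ → ℝ} {A C m : ℝ}
    (hGm : Measurable G) (hG0 : ∀ t, 0 ≤ G t) (hG1 : ∀ t, G t ≤ 1)
    (hGneg : ∀ t ≤ 0, G t = 0) (hA : 0 < A) (hC : 0 < C)
    (hG : Tendsto (fun t => G t / (A * t ^ m * exp (-C / t))) (𝓝[>] 0) (𝓝 1)) :
    Tendsto (fun y : ℝ => ∫ u : ℝ, G (C / y ^ 2 * (1 + u / y)) / (C / y ^ 2) ^ m *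
      exp (2 * y ^ 2 - y ^ 2 * (1 + u / y))) atTop (𝓝 (A * √π)) := by
  obtain ⟨D, hD⟩ := exists_rescaled_le hG1 hGneg hA hC hG
  have hint : ∫ u : ℝ, A * exp (-1 * u ^ 2) = A * √π := by
    rw [integral_const_mul, integral_gaussian, div_one]
  rw [← hint]
  refine tendsto_integral_filter_of_dominated_convergence (fun u => D * exp (-(|u| / 2)))
    (Eventually.of_forall fun y => Measurable.aestronglyMeasurable (by fun_prop)) ?_
    (integrable_exp_neg_half_abs.const_mul D)
    (Eventually.of_forall fun u => tendsto_rescaled hA hC hG u)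
  filter_upwards [eventually_ge_atTop 1,
    (tendsto_pow_atTop (α := ℝ) two_ne_zero).eventually_ge_atTop C] with y hy hCy
  refine Eventually.of_forall fun u => ?_
  have : 0 ≤ (C / y ^ 2) ^ m := by positivity
  rw [Real.norm_of_nonneg (mul_nonneg (div_nonneg (hG0 _) this) (exp_pos _).le)]
  exact hD y hy hCy u

/-- Change of variables centering the Laplace transform at its saddle point. -/
lemma integral_laplace_eq_rescaled (G : ℝ → ℝ) {C y : ℝ} (m : ℝ) (hC : 0 < C) (hy : 0 < y) :
    ∫ t, y ^ 4 / C * exp (-(y ^ 4 / C * t)) * G t =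
      y * (C / y ^ 2) ^ m * exp (-2 * y ^ 2) *
        ∫ u : ℝ, G (C / y ^ 2 * (1 + u / y)) / (C / y ^ 2) ^ m *
          exp (2 * y ^ 2 - y ^ 2 * (1 + u / y)) := by
  set f : ℝ → ℝ := fun t => y ^ 4 / C * exp (-(y ^ 4 / C * t)) * G t with hf
  have hTm : 0 < (C / y ^ 2) ^ m := by positivity
  have h1 : ∫ u : ℝ, f (C / y ^ 3 * u + C / y ^ 2) = y ^ 3 / C * ∫ t, f t := by
    rw [Measure.integral_comp_mul_left (fun v => f (v + C / y ^ 2)) (C / y ^ 3),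
      integral_add_right_eq_self, abs_of_pos (by positivity), smul_eq_mul, inv_div]
  have h2 : ∫ t, f t = C / y ^ 3 * ∫ u : ℝ, f (C / y ^ 3 * u + C / y ^ 2) := by
    rw [h1]; field_simp
  rw [h2, ← integral_const_mul, ← integral_const_mul]
  congr 1
  ext u
  have e1 : C / y ^ 3 * u + C / y ^ 2 = C / y ^ 2 * (1 + u / y) := by field_simp; ring
  have e2 : y ^ 4 / C * (C / y ^ 2 * (1 + u / y)) = y ^ 2 * (1 + u / y) := by field_simp
  have e3 : exp (-(y ^ 2 * (1 + u / y))) =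
      exp (-2 * y ^ 2) * exp (2 * y ^ 2 - y ^ 2 * (1 + u / y)) := by
    rw [← Real.exp_add]; congr 1; ring
  simp only [hf]
  rw [e1, e2, e3]
  field_simp

/-- Abelian asymptotics of the Laplace transform of a bounded function which behaves like
`A t ^ m exp (-C / t)` near zero. -/
lemma tendsto_laplace_div {G : ℝ → ℝ} {A C m : ℝ}
    (hGm : Measurable G) (hG0 : ∀ t, 0 ≤ G t) (hG1 : ∀ t, G t ≤ 1)
    (hGneg : ∀ t ≤ 0, G t = 0) (hA : 0 < A) (hC : 0 < C)
    (hG : Tendsto (fun t => G t / (A * t ^ m * exp (-C / t))) (𝓝[>] 0) (𝓝 1)) :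
    Tendsto (fun r : ℝ => (∫ t, r * exp (-(r * t)) * G t) /
      (A * √π * C ^ ((2 * m + 1) / 4) * r ^ ((1 - 2 * m) / 4) * exp (-2 * √C * √r)))
      atTop (𝓝 1) := by
  have hy : Tendsto (fun r : ℝ => (C * r) ^ (1 / 4 : ℝ)) atTop atTop :=
    (tendsto_rpow_atTop (by norm_num)).comp (tendsto_id.const_mul_atTop hC)
  have h := ((tendsto_integral_rescaled hGm hG0 hG1 hGneg hA hC hG).comp hy).div_const (A * √π)
  have hAπ : 0 < A * √π := by positivity
  rw [div_self hAπ.ne'] at h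
  refine h.congr' ?_
  filter_upwards [eventually_gt_atTop 0] with r hr
  have hCr : 0 < C * r := by positivity
  have hypos : 0 < (C * r) ^ (1 / 4 : ℝ) := by positivity
  have hy2 : ((C * r) ^ (1 / 4 : ℝ)) ^ 2 = √C * √r := by
    rw [← Real.rpow_natCast, ← Real.rpow_mul hCr.le, ← Real.sqrt_mul hC.le, Real.sqrt_eq_rpow]
    norm_num
  have hy4 : ((C * r) ^ (1 / 4 : ℝ)) ^ 4 / C = r := by
    rw [← Real.rpow_natCast, ← Real.rpow_mul hCr.le]
    norm_num
    field_simp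
  have hcv := integral_laplace_eq_rescaled G m hC hypos
  rw [hy4] at hcv
  have hpre : (C * r) ^ (1 / 4 : ℝ) * (C / ((C * r) ^ (1 / 4 : ℝ)) ^ 2) ^ m =
      C ^ ((2 * m + 1) / 4) * r ^ ((1 - 2 * m) / 4) := by
    rw [hy2, Real.sqrt_eq_rpow, Real.sqrt_eq_rpow, Real.mul_rpow hC.le hr.le,
      Real.rpow_def_of_pos hC, Real.rpow_def_of_pos hC, Real.rpow_def_of_pos hC,
      Real.rpow_def_of_pos hr, Real.rpow_def_of_pos hr, Real.rpow_def_of_pos hr]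
    nth_rewrite 2 [← Real.exp_log hC]
    rw [← Real.exp_add, ← Real.exp_add, ← Real.exp_sub, ← Real.exp_mul, ← Real.exp_add,
      ← Real.exp_add]
    congr 1
    ring
  have hpre_pos : 0 < C ^ ((2 * m + 1) / 4) * r ^ ((1 - 2 * m) / 4) := by positivity
  simp only [Function.comp_apply]
  rw [hcv, hpre, show -2 * ((C * r) ^ (1 / 4 : ℝ)) ^ 2 = -2 * √C * √r by rw [hy2]; ring]
  have he := exp_pos (-2 * √C * √r)
  rw [mul_assoc (A * √π), mul_assoc (A * √π), mul_comm (A * √π),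
    mul_div_mul_left _ _ (by positivity)]

/-- The probability of an event happening before an independent exponential clock, as a Laplace
transform of the distribution function. -/
lemma measure_lt_exponential_eq_integral {Ω : Type*} [MeasurableSpace Ω] (μ : Measure Ω)
    [IsProbabilityMeasure μ] {τ : Ω → ℝ} {κ : Ω → ℕ} {σ : Ω → ℝ} (hτ : Measurable τ)
    (hκ : Measurable κ) (hσ : Measurable σ) (hτpos : ∀ᵐ ω ∂μ, 0 < τ ω) {r : ℝ} (hr : 0 < r)
    (hdist : Measure.map σ μ = expMeasure r)
    (hindep : IndepFun (fun ω => (τ ω, κ ω)) σ μ) (S : Set ℕ) :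
    (μ {ω | κ ω ∈ S ∧ τ ω < σ ω}).toReal =
      ∫ t, r * exp (-(r * t)) * (μ {ω | τ ω ≤ t ∧ κ ω ∈ S}).toReal := by
  have hmono : Monotone fun t => μ {ω | τ ω ≤ t ∧ κ ω ∈ S} := fun a b hab =>
    measure_mono fun ω hω => ⟨hω.1.trans hab, hω.2⟩
  have : IsProbabilityMeasure (expMeasure r) := isProbabilityMeasure_expMeasure hr
  have hac : expMeasure r ≪ volume := withDensity_absolutelyContinuous _ _
  have hprod := (indepFun_iff_map_prod_eq_prod_map_map (hτ.prodMk hκ).aemeasurable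
    hσ.aemeasurable).1 hindep
  rw [hdist] at hprod
  have hE : MeasurableSet {p : (ℝ × ℕ) × ℝ | p.1.2 ∈ S ∧ p.1.1 < p.2} :=
    (MeasurableSet.of_discrete (s := S) |>.preimage (by fun_prop)).inter
      (measurableSet_lt (measurable_fst.comp measurable_fst) measurable_snd)
  have h1 : μ {ω | κ ω ∈ S ∧ τ ω < σ ω} =
      ∫⁻ t, μ {ω | κ ω ∈ S ∧ τ ω < t} ∂expMeasure r := by
    have h := congrArg (fun ν => ν {p : (ℝ × ℕ) × ℝ | p.1.2 ∈ S ∧ p.1.1 < p.2}) hprod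
    have : IsProbabilityMeasure (Measure.map (fun ω => (τ ω, κ ω)) μ) :=
      Measure.isProbabilityMeasure_map (hτ.prodMk hκ).aemeasurable
    rw [Measure.map_apply ((hτ.prodMk hκ).prodMk hσ) hE, Measure.prod_apply_symm hE] at h
    refine h.trans (lintegral_congr fun t => ?_)
    rw [Measure.map_apply (hτ.prodMk hκ) (hE.preimage (by fun_prop))]
    rfl
  have h2 : ∀ᵐ t ∂expMeasure r,
      μ {ω | κ ω ∈ S ∧ τ ω < t} = μ {ω | τ ω ≤ t ∧ κ ω ∈ S} := by
    have hc := (Measure.countable_meas_level_set_pos (μ := μ) hτ).ae_notMem (volume : Measure ℝ)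
    filter_upwards [hac.ae_le hc] with t ht
    have ht0 : μ {ω | τ ω = t} = 0 := by simpa using ht
    refine measure_congr ?_
    have hne : ∀ᵐ ω ∂μ, τ ω ≠ t := by rw [ae_iff]; simpa using ht0
    filter_upwards [hne] with ω hω
    refine propext ⟨fun h => ⟨h.2.le, h.1⟩, fun h => ⟨h.2, lt_of_le_of_ne h.1 hω⟩⟩
  rw [h1, lintegral_congr_ae h2, ← integral_toReal hmono.measurable.aemeasurable
    (Eventually.of_forall fun t => measure_lt_top _ _)]
  have hmeas : Measurable (exponentialPDF r) :=
    (measurable_exponentialPDFReal r).ennreal_ofReal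
  change ∫ t, _ ∂(volume.withDensity (exponentialPDF r)) = _
  rw [integral_withDensity_eq_integral_toReal_smul hmeas
    (Eventually.of_forall fun t => ENNReal.ofReal_lt_top)]
  refine integral_congr_ae (Eventually.of_forall fun t => ?_)
  simp only [smul_eq_mul]
  rcases le_or_gt 0 t with ht | ht
  · rw [exponentialPDF_of_nonneg ht, ENNReal.toReal_ofReal (by positivity)]
  · have : μ {ω | τ ω ≤ t ∧ κ ω ∈ S} = 0 := by
      refine measure_mono_null (fun ω hω => ?_) (ae_iff.1 hτpos)
      exact not_lt.2 (hω.1.trans ht.le)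
    rw [this]
    simp

/-- Asymptotics of the probability of hitting before a fast exponential clock. -/
lemma tendsto_measure_lt_exponential_div {Ω : Type*} [MeasurableSpace Ω] (μ : Measure Ω)
    [IsProbabilityMeasure μ] {τ : Ω → ℝ} {κ : Ω → ℕ} {σ : ℝ → Ω → ℝ} (hτ : Measurable τ)
    (hκ : Measurable κ) (hσ : ∀ r, Measurable (σ r)) (hτpos : ∀ᵐ ω ∂μ, 0 < τ ω)
    (hdist : ∀ r > 0, Measure.map (σ r) μ = expMeasure r)
    (hindep : ∀ r > 0, IndepFun (fun ω => (τ ω, κ ω)) (σ r) μ) (S : Set ℕ)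
    {A C m : ℝ} (hA : 0 < A) (hC : 0 < C)
    (hF : Tendsto (fun t => (μ {ω | τ ω ≤ t ∧ κ ω ∈ S}).toReal /
      (A * t ^ m * exp (-C / t))) (𝓝[>] 0) (𝓝 1)) :
    Tendsto (fun r : ℝ => (μ {ω | κ ω ∈ S ∧ τ ω < σ r ω}).toReal /
      (A * √π * C ^ ((2 * m + 1) / 4) * r ^ ((1 - 2 * m) / 4) * exp (-2 * √C * √r)))
      atTop (𝓝 1) := by
  have hmono : Monotone fun t => μ {ω | τ ω ≤ t ∧ κ ω ∈ S} := fun a b hab =>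
    measure_mono fun ω hω => ⟨hω.1.trans hab, hω.2⟩
  refine (tendsto_laplace_div hmono.measurable.ennreal_toReal
    (fun t => ENNReal.toReal_nonneg) (fun t => ?_) (fun t ht => ?_) hA hC hF).congr' ?_
  · exact ENNReal.toReal_le_of_le_ofReal zero_le_one (by simpa using prob_le_one)
  · have : μ {ω | τ ω ≤ t ∧ κ ω ∈ S} = 0 := by
      refine measure_mono_null (fun ω hω => ?_) (ae_iff.1 hτpos)
      exact not_lt.2 (hω.1.trans ht)
    rw [this, ENNReal.toReal_zero]
  · filter_upwards [eventually_gt_atTop 0] with r hr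
    rw [measure_lt_exponential_eq_integral μ hτ hκ (hσ r) hτpos hr (hdist r hr) (hindep r hr) S]

/-- Conditional hitting probability asymptotics under exponentially distributed resetting:
if `F_τ(t) ∼ A t^m e^{-C/t}` and `F_τ^{(k)}(t) ∼ B t^n e^{-C_k/t}` as `t → 0⁺`, and `σ_r`
is exponentially distributed with rate `r`, independent of `(τ, κ)`, then
`P(κ = k | τ < σ_r) ∼ ξ r^{(m-n)/2} e^{-2(√C_k-√C)√r}` as `r → ∞`, where
`ξ = (B/A) C_k^{(2n+1)/4} / C^{(2m+1)/4}`. -/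
theorem conditional_hitting_exponential
    {Ω : Type*} [MeasurableSpace Ω] (μ : Measure Ω) [IsProbabilityMeasure μ]
    (τ : Ω → ℝ) (κ : Ω → ℕ) (k : ℕ) (σ : ℝ → Ω → ℝ)
    (hτ : Measurable τ) (hκ : Measurable κ) (hσ : ∀ r, Measurable (σ r))
    (hτpos : ∀ᵐ ω ∂μ, 0 < τ ω)
    (A B C Ck m n : ℝ)
    (hA : 0 < A) (hB : 0 < B) (hC : 0 < C) (hCk : C < Ck)
    (hdist : ∀ r > 0, Measure.map (σ r) μ = expMeasure r)
    (hindep : ∀ r > 0, IndepFun (fun ω => (τ ω, κ ω)) (σ r) μ)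
    (hF : Tendsto (fun t => (μ {ω | τ ω ≤ t}).toReal /
        (A * t ^ m * Real.exp (-C / t))) (𝓝[>] 0) (𝓝 1))
    (hFk : Tendsto (fun t => (μ {ω | τ ω ≤ t ∧ κ ω = k}).toReal /
        (B * t ^ n * Real.exp (-Ck / t))) (𝓝[>] 0) (𝓝 1))
    (hppos : ∀ r > 0, 0 < (μ {ω | τ ω < σ r ω}).toReal)
    (hpkpos : ∀ r > 0, 0 < (μ {ω | κ ω = k ∧ τ ω < σ r ω}).toReal) :
    Tendsto (fun r : ℝ =>
        ((μ {ω | κ ω = k ∧ τ ω < σ r ω}).toReal / (μ {ω | τ ω < σ r ω}).toReal) /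
          ((B / A * (Ck ^ ((2 * n + 1) / 4) / C ^ ((2 * m + 1) / 4))) *
            r ^ ((m - n) / 2) *
            Real.exp (-2 * (Real.sqrt Ck - Real.sqrt C) * Real.sqrt r)))
      atTop (𝓝 1) := by
  have hkS : Tendsto _ _ _ := tendsto_measure_lt_exponential_div μ hτ hκ hσ hτpos hdist hindep {k}
    hB (hC.trans hCk) hFk
  have hS : Tendsto _ _ _ := tendsto_measure_lt_exponential_div μ hτ hκ hσ hτpos hdist hindep univ
    hA hC (by simpa using hF)
  simp only [mem_singleton_iff] at hkS
  simp only [mem_univ, true_and] at hS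
  have h := hkS.div hS one_ne_zero
  rw [div_one] at h
  refine h.congr' ?_
  filter_upwards [eventually_gt_atTop 0] with r hr
  have hCk0 : 0 < Ck := hC.trans hCk
  have e1 : r ^ ((1 - 2 * n) / 4) = r ^ ((m - n) / 2) * r ^ ((1 - 2 * m) / 4) := by
    rw [← Real.rpow_add hr]; congr 1; ring
  have e2 : Real.exp (-2 * √Ck * √r) =
      Real.exp (-2 * (√Ck - √C) * √r) * Real.exp (-2 * √C * √r) := by
    rw [← Real.exp_add]; congr 1; ring
  have hp := hppos r hr
  simp only [Pi.div_apply]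
  rw [e1, e2]
  field_simp
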